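/- Let A = (a_1, …, a_d) and B = (b_1, …, b_d) be arbitrary orthonormal bases of ℂ^d, and let f(A,B) = max_{j,k} |⟨a_j, b_k⟩|. Then for every unit vector ψ ∈ ℂ^d, the entropy excess satisfies X(A,B) = H(A) − R(B) ≥ 2 log(1/f(A,B)) − log d, where H(A) = −∑_j p_j log p_j with p_j = |⟨a_j, ψ⟩|² and R(B) = ∑_k q_k log(d q_k) with q_k = |⟨b_k, ψ⟩|². -/

import Mathlib

open scoped InnerProductSpace

/-- Probability of outcome `j` when measuring the basis `A` on the state `ψ`. -/
noncomputable def measProb {d : ℕ}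
    (A : OrthonormalBasis (Fin d) ℂ (EuclideanSpace ℂ (Fin d)))
    (ψ : EuclideanSpace ℂ (Fin d)) (j : Fin d) : ℝ :=
  ‖⟪A j, ψ⟫_ℂ‖ ^ 2

/-- Shannon entropy of the measurement distribution of basis `A` on state `ψ`. -/
noncomputable def measEntropy {d : ℕ}
    (A : OrthonormalBasis (Fin d) ℂ (EuclideanSpace ℂ (Fin d)))
    (ψ : EuclideanSpace ℂ (Fin d)) : ℝ :=
  -∑ j, measProb A ψ j * Real.log (measProb A ψ j)

/-- Entropic knowledge of the measurement distribution of basis `A` on state `ψ`. -/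
noncomputable def measKnowledge {d : ℕ}
    (A : OrthonormalBasis (Fin d) ℂ (EuclideanSpace ℂ (Fin d)))
    (ψ : EuclideanSpace ℂ (Fin d)) : ℝ :=
  ∑ j, measProb A ψ j * Real.log (d * measProb A ψ j)

/-- The maximal overlap `f(A,B) = max_{j,k} |⟨a_j, b_k⟩|` of two orthonormal bases. -/
noncomputable def maxOverlap {d : ℕ}
    (A B : OrthonormalBasis (Fin d) ℂ (EuclideanSpace ℂ (Fin d))) : ℝ :=
  ⨆ jk : Fin d × Fin d, ‖⟪A jk.1, B jk.2⟫_ℂ‖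

section Reweight

variable {ι E : Type*} [Fintype ι] [NormedAddCommGroup E] [InnerProductSpace ℂ E]

/-- The vector whose coordinates in the basis `A` are those of `ψ`, each multiplied by the `z`-th
power of its modulus. -/
noncomputable def reweight (A : OrthonormalBasis ι ℂ E) (ψ : E) (z : ℂ) : E :=
  ∑ j, (⟪A j, ψ⟫_ℂ * Complex.exp (z * Real.log ‖⟪A j, ψ⟫_ℂ‖)) • A j

lemma reweight_zero (A : OrthonormalBasis ι ℂ E) (ψ : E) : reweight A ψ 0 = ψ := by
  simp [reweight, A.sum_repr']

lemma norm_reweight_le_one (A : OrthonormalBasis ι ℂ E) {ψ : E} (hψ : ‖ψ‖ = 1) {z : ℂ}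
    (hz : 0 ≤ z.re) : ‖reweight A ψ z‖ ≤ 1 := by
  rw [← sq_le_one_iff₀ (norm_nonneg _)]
  calc ‖reweight A ψ z‖ ^ 2
      = ∑ j, ‖⟪A j, ψ⟫_ℂ * Complex.exp (z * Real.log ‖⟪A j, ψ⟫_ℂ‖)‖ ^ 2 := by
        rw [← A.sum_sq_norm_inner_right]
        simp only [reweight, A.orthonormal.inner_right_fintype]
    _ ≤ ∑ j, ‖⟪A j, ψ⟫_ℂ‖ ^ 2 := by
        gcongr with j
        rw [norm_mul, Complex.norm_exp, Complex.re_mul_ofReal]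
        refine mul_le_of_le_one_right (norm_nonneg _) (Real.exp_le_one_iff.2 ?_)
        refine mul_nonpos_of_nonneg_of_nonpos hz (Real.log_nonpos (norm_nonneg _) ?_)
        simpa [hψ] using norm_inner_le_norm (𝕜 := ℂ) (A j) ψ
    _ = 1 := by rw [A.sum_sq_norm_inner_right, hψ, one_pow]

lemma norm_mul_exp_mul_log_norm_of_re_eq_one (w : ℂ) {z : ℂ} (hz : z.re = 1) :
    ‖w * Complex.exp (z * Real.log ‖w‖)‖ = ‖w‖ ^ 2 := by
  rcases eq_or_ne w 0 with rfl | hw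
  · simp
  · rw [norm_mul, Complex.norm_exp, Complex.re_mul_ofReal, hz, one_mul,
      Real.exp_log (norm_pos_iff.2 hw), sq]

lemma norm_inner_reweight_le {κ : Type*} [Fintype κ] (A : OrthonormalBasis ι ℂ E)
    (B : OrthonormalBasis κ ℂ E) {ψ : E} (hψ : ‖ψ‖ = 1) {c : ℝ}
    (hc : ∀ j k, ‖⟪A j, B k⟫_ℂ‖ ≤ c) {z w : ℂ} (hz : z.re = 1) (hw : w.re = 1) :
    ‖⟪reweight A ψ w, reweight B ψ z⟫_ℂ‖ ≤ c := by
  simp only [reweight, sum_inner, inner_sum, inner_smul_left, inner_smul_right, Finset.mul_sum]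
  calc _ ≤ ∑ k, ∑ j, ‖⟪B k, ψ⟫_ℂ‖ ^ 2 * (‖⟪A j, ψ⟫_ℂ‖ ^ 2 * c) := by
        refine (norm_sum_le _ _).trans (Finset.sum_le_sum fun k _ =>
          (norm_sum_le _ _).trans (Finset.sum_le_sum fun j _ => ?_))
        rw [norm_mul, norm_mul_exp_mul_log_norm_of_re_eq_one _ hz, norm_mul, RCLike.norm_conj,
          norm_mul_exp_mul_log_norm_of_re_eq_one _ hw]
        gcongr
        exact hc j k
    _ = c := by
        simp_rw [← Finset.mul_sum, ← Finset.sum_mul, A.sum_sq_norm_inner_right,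
          B.sum_sq_norm_inner_right]
        simp [hψ]

lemma hasDerivAt_reweight (A : OrthonormalBasis ι ℂ E) (ψ : E) (z : ℂ) :
    HasDerivAt (fun z => reweight A ψ z) (∑ j, (⟪A j, ψ⟫_ℂ *
      (Complex.exp (z * Real.log ‖⟪A j, ψ⟫_ℂ‖) * Real.log ‖⟪A j, ψ⟫_ℂ‖)) • A j) z := by
  unfold reweight
  refine HasDerivAt.fun_sum fun j _ => ((HasDerivAt.const_mul _ ?_).smul_const _)
  exact (hasDerivAt_mul_const _).cexp

open ComplexConjugate in
lemma inner_reweight_conj_left (A : OrthonormalBasis ι ℂ E) (ψ x : E) (z : ℂ) :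
    ⟪reweight A ψ (conj z), x⟫_ℂ =
      ∑ j, ⟪ψ, A j⟫_ℂ * Complex.exp (z * Real.log ‖⟪A j, ψ⟫_ℂ‖) * ⟪A j, x⟫_ℂ := by
  simp only [reweight, sum_inner, inner_smul_left, map_mul, inner_conj_symm, ← Complex.exp_conj,
    Complex.conj_conj, Complex.conj_ofReal]

open ComplexConjugate in
lemma hasDerivAt_inner_reweight {κ : Type*} [Fintype κ] (A : OrthonormalBasis ι ℂ E)
    (B : OrthonormalBasis κ ℂ E) (ψ : E) (z : ℂ) :
    HasDerivAt (fun z => ⟪reweight A ψ (conj z), reweight B ψ z⟫_ℂ)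
      (∑ j, (⟪ψ, A j⟫_ℂ * (Complex.exp (z * Real.log ‖⟪A j, ψ⟫_ℂ‖) * Real.log ‖⟪A j, ψ⟫_ℂ‖) *
          ⟪A j, reweight B ψ z⟫_ℂ +
        ⟪ψ, A j⟫_ℂ * Complex.exp (z * Real.log ‖⟪A j, ψ⟫_ℂ‖) *
          ⟪A j, ∑ k, (⟪B k, ψ⟫_ℂ *
            (Complex.exp (z * Real.log ‖⟪B k, ψ⟫_ℂ‖) * Real.log ‖⟪B k, ψ⟫_ℂ‖)) • B k⟫_ℂ)) z := by
  simp only [inner_reweight_conj_left]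
  refine HasDerivAt.fun_sum fun j _ => HasDerivAt.fun_mul (HasDerivAt.const_mul _ ?_) ?_
  · exact (hasDerivAt_mul_const _).cexp
  · exact (innerSL ℂ (A j)).hasFDerivAt.comp_hasDerivAt z (hasDerivAt_reweight B ψ z)

open ComplexConjugate in
lemma hasDerivAt_inner_reweight_zero {κ : Type*} [Fintype κ] (A : OrthonormalBasis ι ℂ E)
    (B : OrthonormalBasis κ ℂ E) (ψ : E) :
    HasDerivAt (fun z => ⟪reweight A ψ (conj z), reweight B ψ z⟫_ℂ)
      ((∑ j, ‖⟪A j, ψ⟫_ℂ‖ ^ 2 * Real.log ‖⟪A j, ψ⟫_ℂ‖ +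
        ∑ k, ‖⟪B k, ψ⟫_ℂ‖ ^ 2 * Real.log ‖⟪B k, ψ⟫_ℂ‖ : ℝ) : ℂ) 0 := by
  have key (C : E) : ((‖⟪C, ψ⟫_ℂ‖ : ℝ) : ℂ) ^ 2 = ⟪ψ, C⟫_ℂ * ⟪C, ψ⟫_ℂ := by
    rw [← inner_conj_symm ψ C, RCLike.conj_mul]; rfl
  convert hasDerivAt_inner_reweight A B ψ 0 using 1
  simp only [zero_mul, Complex.exp_zero, mul_one, one_mul, reweight_zero, Finset.sum_add_distrib,
    A.sum_inner_mul_inner]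
  simp only [inner_sum, inner_smul_right]
  push_cast
  simp only [key]
  congr 1 <;> exact Finset.sum_congr rfl fun _ _ => by ring

open Complex.HadamardThreeLines ComplexConjugate in
lemma norm_inner_reweight_le_rpow {κ : Type*} [Fintype κ] (A : OrthonormalBasis ι ℂ E)
    (B : OrthonormalBasis κ ℂ E) {ψ : E} (hψ : ‖ψ‖ = 1) {c : ℝ}
    (hc : ∀ j k, ‖⟪A j, B k⟫_ℂ‖ ≤ c) {z : ℂ} (h0 : 0 ≤ z.re) (h1 : z.re ≤ 1) :
    ‖⟪reweight A ψ (conj z), reweight B ψ z⟫_ℂ‖ ≤ c ^ z.re := by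
  have hbound (z : ℂ) (hz : 0 ≤ z.re) : ‖⟪reweight A ψ (conj z), reweight B ψ z⟫_ℂ‖ ≤ 1 :=
    (norm_inner_le_norm _ _).trans (mul_le_one₀ (norm_reweight_le_one A hψ (by simpa using hz))
      (norm_nonneg _) (norm_reweight_le_one B hψ hz))
  have hdiff : Differentiable ℂ (fun z => ⟪reweight A ψ (conj z), reweight B ψ z⟫_ℂ) :=
    fun z => (hasDerivAt_inner_reweight A B ψ z).differentiableAt
  have := norm_le_interp_of_mem_verticalClosedStrip₀₁'
    (fun z => ⟪reweight A ψ (conj z), reweight B ψ z⟫_ℂ) (a := 1) (b := c) (z := z) ⟨h0, h1⟩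
    hdiff.diffContOnCl ⟨1, by rintro _ ⟨w, hw, rfl⟩; exact hbound w hw.1⟩
    (fun w hw => hbound w (le_of_eq hw.symm))
    (fun w hw => norm_inner_reweight_le A B hψ hc hw (by simpa using hw))
  simpa using this

/-- The **Maassen–Uffink** entropic uncertainty relation, in terms of moduli of amplitudes. -/
theorem sum_norm_sq_mul_log_norm_le {κ : Type*} [Fintype κ] (A : OrthonormalBasis ι ℂ E)
    (B : OrthonormalBasis κ ℂ E) {ψ : E} (hψ : ‖ψ‖ = 1) {c : ℝ} (hc0 : 0 < c)
    (hc : ∀ j k, ‖⟪A j, B k⟫_ℂ‖ ≤ c) :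
    ∑ j, ‖⟪A j, ψ⟫_ℂ‖ ^ 2 * Real.log ‖⟪A j, ψ⟫_ℂ‖ +
      ∑ k, ‖⟪B k, ψ⟫_ℂ‖ ^ 2 * Real.log ‖⟪B k, ψ⟫_ℂ‖ ≤ Real.log c := by
  have hpow : HasDerivAt (fun x : ℝ => c ^ x) (Real.log c) 0 := by
    simpa using (Real.hasStrictDerivAt_const_rpow hc0 0).hasDerivAt
  have hF := HasDerivAt.real_of_complex (z := 0)
    (by simpa only [Complex.ofReal_zero] using hasDerivAt_inner_reweight_zero A B ψ)
  rw [Complex.ofReal_re] at hF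
  refine le_of_tendsto_of_tendsto hF.tendsto_slope_zero_right hpow.tendsto_slope_zero_right ?_
  filter_upwards [Ioo_mem_nhdsGT one_pos] with t ht
  have h := (Complex.re_le_norm _).trans
    (norm_inner_reweight_le_rpow A B hψ hc (z := t) (by simpa using ht.1.le)
      (by simpa using ht.2.le))
  simp only [Complex.ofReal_re] at h
  rw [smul_eq_mul, smul_eq_mul]
  refine mul_le_mul_of_nonneg_left ?_ (inv_nonneg.2 ht.1.le)
  simpa [reweight_zero, hψ] using h

end Reweight

lemma inner_le_maxOverlap {d : ℕ} (A B : OrthonormalBasis (Fin d) ℂ (EuclideanSpace ℂ (Fin d)))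
    (j k : Fin d) : ‖⟪A j, B k⟫_ℂ‖ ≤ maxOverlap A B :=
  le_ciSup (f := fun jk : Fin d × Fin d => ‖⟪A jk.1, B jk.2⟫_ℂ‖) (Set.finite_range _).bddAbove
    (j, k)

lemma maxOverlap_pos {d : ℕ} (hd : 0 < d)
    (A B : OrthonormalBasis (Fin d) ℂ (EuclideanSpace ℂ (Fin d))) : 0 < maxOverlap A B := by
  by_contra! h
  have h0 : ∑ j, ‖⟪A j, B ⟨0, hd⟩⟫_ℂ‖ ^ 2 = 0 := Finset.sum_eq_zero fun j _ => by
    rw [((inner_le_maxOverlap A B j _).trans h).antisymm (norm_nonneg _), sq, zero_mul]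
  simp [A.sum_sq_norm_inner_right] at h0

lemma sum_measProb {d : ℕ} (A : OrthonormalBasis (Fin d) ℂ (EuclideanSpace ℂ (Fin d)))
    {ψ : EuclideanSpace ℂ (Fin d)} (hψ : ‖ψ‖ = 1) : ∑ j, measProb A ψ j = 1 := by
  simp [measProb, A.sum_sq_norm_inner_right, hψ]

lemma measEntropy_eq {d : ℕ} (A : OrthonormalBasis (Fin d) ℂ (EuclideanSpace ℂ (Fin d)))
    (ψ : EuclideanSpace ℂ (Fin d)) :
    measEntropy A ψ = -(2 * ∑ j, ‖⟪A j, ψ⟫_ℂ‖ ^ 2 * Real.log ‖⟪A j, ψ⟫_ℂ‖) := by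
  simp only [measEntropy, measProb, Real.log_pow, Finset.mul_sum]
  push_cast
  congr 1
  exact Finset.sum_congr rfl fun _ _ => by ring

lemma measKnowledge_eq {d : ℕ} (hd : 0 < d)
    (A : OrthonormalBasis (Fin d) ℂ (EuclideanSpace ℂ (Fin d)))
    {ψ : EuclideanSpace ℂ (Fin d)} (hψ : ‖ψ‖ = 1) :
    measKnowledge A ψ = Real.log d - measEntropy A ψ := by
  have key (j : Fin d) : measProb A ψ j * Real.log (d * measProb A ψ j) =
      measProb A ψ j * Real.log d + measProb A ψ j * Real.log (measProb A ψ j) := by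
    rcases eq_or_ne (measProb A ψ j) 0 with h | h
    · simp [h]
    · rw [Real.log_mul (by positivity) h, mul_add]
  simp only [measKnowledge, measEntropy, key, Finset.sum_add_distrib, ← Finset.sum_mul,
    sum_measProb A hψ]
  ring

/-- For arbitrary orthonormal bases `A`, `B` of `ℂ^d` and any unit
vector `ψ`, the entropy excess satisfies
`X(A,B) = H(A) − R(B) ≥ 2 log (1 / f(A,B)) − log d`. -/
theorem entropy_excess_ge_of_maxOverlap (d : ℕ) (hd : 0 < d)
    (A B : OrthonormalBasis (Fin d) ℂ (EuclideanSpace ℂ (Fin d)))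
    (ψ : EuclideanSpace ℂ (Fin d)) (hψ : ‖ψ‖ = 1) :
    measEntropy A ψ - measKnowledge B ψ ≥
      2 * Real.log (1 / maxOverlap A B) - Real.log d := by
  have h := sum_norm_sq_mul_log_norm_le A B hψ (maxOverlap_pos hd A B) (inner_le_maxOverlap A B)
  rw [measKnowledge_eq hd B hψ, measEntropy_eq, measEntropy_eq, one_div, Real.log_inv]
  linarith
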